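/- Let G = G₁ × ⋯ × Gₘ = H₁ × ⋯ × Hₙ be two decompositions of a finite group G into directly indecomposable factors. Then for every i there exists j with Gᵢ·Z(G) = Hⱼ·Z(G), and this correspondence is given by a permutation (so n = m and each Gᵢ ≅ H_{σ(i)}). -/

import Mathlib

/-- A group is directly indecomposable: it is nontrivial and admits no nontrivial
internal direct product decomposition. -/
def DirectlyIndecomposable (K : Type*) [Group K] : Prop :=
  Nontrivial K ∧ ∀ H₁ H₂ : Subgroup K, H₁.Normal → H₂.Normal →
    H₁ ⊓ H₂ = ⊥ → H₁ ⊔ H₂ = ⊤ → H₁ = ⊥ ∨ H₂ = ⊥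

def KEqv {K : Type*} [Group K] (φ : K →* K) : Prop := ∀ g x, φ (g * x * g⁻¹) = g * φ x * g⁻¹

theorem exists_idem_pow {M : Type*} [Monoid M] [Finite M] (a : M) :
    ∃ k, 0 < k ∧ a ^ k * a ^ k = a ^ k := by
  obtain ⟨p, q, hne, hpq⟩ := Finite.exists_ne_map_eq_of_infinite (fun n : ℕ => a ^ n)
  wlog hlt : p < q generalizing p q
  · exact this q p hne.symm hpq.symm (by omega)
  obtain ⟨d, hd⟩ := Nat.exists_eq_add_of_lt hlt
  have h1 : ∀ c k, p ≤ k → a ^ (k + c * (d + 1)) = a ^ k := by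
    intro c
    induction c with
    | zero => simp
    | succ c ih =>
      intro k hk
      obtain ⟨r, rfl⟩ := Nat.exists_eq_add_of_le hk
      rw [← ih _ hk]
      have e1 : p + r + (c + 1) * (d + 1) = q + (r + c * (d + 1)) := by rw [hd]; ring
      have e2 : p + r + c * (d + 1) = p + (r + c * (d + 1)) := by ring
      rw [e1, e2, pow_add, pow_add a p, hpq]
  refine ⟨(p + 1) * (d + 1), by positivity, ?_⟩
  rw [← pow_add]
  exact h1 _ _ (by nlinarith)

theorem kfitting {K : Type*} [Group K] [Finite K] (hK : DirectlyIndecomposable K)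
    (φ : K →* K) (hφ : KEqv φ) :
    Function.Bijective φ ∨ ∃ n : ℕ, ∀ x, φ^[n] x = 1 := by
  have : Finite (Monoid.End K) := Finite.of_injective (fun f : Monoid.End K => (f : K → K))
    DFunLike.coe_injective
  obtain ⟨k, hk, hidem⟩ := exists_idem_pow (M := Monoid.End K) φ
  set ψ : Monoid.End K := HPow.hPow (α := Monoid.End K) φ k with hψ
  have hψφ : ∀ x, ψ x = φ^[k] x := by
    intro x
    exact congrFun (Monoid.End.coe_pow K (φ : Monoid.End K) k) x
  have hidem' : ∀ x, ψ (ψ x) = ψ x := fun x => DFunLike.congr_fun hidem x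
  have hit : ∀ (n : ℕ) g x, φ^[n] (g * x * g⁻¹) = g * φ^[n] x * g⁻¹ := by
    intro n
    induction n with
    | zero => simp
    | succ n ih => intro g x; rw [Function.iterate_succ_apply', ih, hφ, Function.iterate_succ_apply']
  let χ : K →* K := ψ
  have hχ : ∀ x, χ x = ψ x := fun _ => rfl
  have hrn : χ.range.Normal := by
    refine ⟨?_⟩
    rintro _ ⟨x, rfl⟩ g
    exact ⟨g * x * g⁻¹, by rw [hχ, hχ, hψφ, hψφ, hit]⟩
  have hbot : χ.ker ⊓ χ.range = ⊥ := by
    rw [eq_bot_iff]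
    rintro _ ⟨h1, ⟨x, rfl⟩⟩
    have h2 : χ (χ x) = 1 := h1
    rw [Subgroup.mem_bot, ← h2]
    exact (hidem' x).symm
  have htop : χ.ker ⊔ χ.range = ⊤ := by
    rw [eq_top_iff]
    intro x _
    have : x = (x * (χ x)⁻¹) * χ x := by group
    rw [this]
    refine Subgroup.mul_mem_sup ?_ ⟨x, rfl⟩
    rw [MonoidHom.mem_ker, map_mul, map_inv]
    have : χ (χ x) = χ x := hidem' x
    rw [this]; group
  rcases hK.2 χ.ker χ.range inferInstance hrn hbot htop with h | h
  · left
    have hinj : Function.Injective χ := (MonoidHom.ker_eq_bot_iff χ).1 h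
    refine Finite.injective_iff_bijective.1 ?_
    intro x y hxy
    apply hinj
    rw [hχ, hχ, hψφ, hψφ]
    obtain ⟨r, rfl⟩ := Nat.exists_eq_succ_of_ne_zero hk.ne'
    rw [Function.iterate_succ_apply, Function.iterate_succ_apply, hxy]
  · right
    refine ⟨k, fun x => ?_⟩
    rw [← hψφ, ← hχ]
    have : χ x ∈ χ.range := ⟨x, rfl⟩
    rw [h] at this
    exact Subgroup.mem_bot.1 this

theorem kadd {K : Type*} [Group K] [Finite K] (hK : DirectlyIndecomposable K)
    (φ ψ θ : K →* K) (hψ : KEqv ψ) (hθ : KEqv θ)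
    (h : ∀ x, θ x = φ x * ψ x) (hb : Function.Bijective θ) :
    Function.Bijective φ ∨ Function.Bijective ψ := by
  by_cases hi : Function.Injective φ
  · exact Or.inl (Finite.injective_iff_bijective.1 hi)
  right
  rw [← MonoidHom.ker_eq_bot_iff, Subgroup.eq_bot_iff_forall] at hi
  push Not at hi
  obtain ⟨x, hx, hx1⟩ := hi
  have hx' : ψ x = θ x := by rw [h, MonoidHom.mem_ker.1 hx, one_mul]
  let T := MulEquiv.ofBijective θ hb
  have hT : ∀ y, θ (T.symm y) = y := fun y => T.apply_symm_apply y
  let β : K →* K := ψ.comp T.symm.toMonoidHom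
  have hβ : ∀ y, β y = ψ (T.symm y) := fun _ => rfl
  have hTs : ∀ g y, T.symm (g * y * g⁻¹) = g * T.symm y * g⁻¹ := by
    intro g y
    apply hb.1
    rw [hT, hθ, hT]
  have hβe : KEqv β := by
    intro g y
    rw [hβ, hβ, hTs, hψ]
  have hfix : β (θ x) = θ x := by
    rw [hβ, ← hx']
    congr 1
    rw [hx']; exact T.symm_apply_apply x
  have hbb : Function.Bijective β := by
    rcases kfitting hK β hβe with h1 | ⟨n, hn⟩
    · exact h1
    · exfalso
      have := hn (θ x)
      rw [Function.iterate_fixed hfix] at this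
      exact hx1 (hb.1 (this.trans (map_one θ).symm))
  have : (ψ : K → K) = β ∘ T := by
    funext y
    simp [hβ]
  rw [this]
  exact hbb.comp T.bijective

structure KDec {G : Type*} [Group G] {ι : Type*} (D : ι → Subgroup G) : Prop where
  nor : ∀ i, (D i).Normal
  ind : iSupIndep D
  sup : ⨆ i, D i = ⊤
  ide : ∀ i, DirectlyIndecomposable (D i)

theorem kproj {G : Type*} [Group G] {ι : Type*} [Fintype ι] [DecidableEq ι]
    (D : ι → Subgroup G) (hD : KDec D) :
    ∃ f : Finset ι → (G →* G), (∀ S, KEqv (f S)) ∧ (∀ x, f ∅ x = 1) ∧ (∀ x, f Finset.univ x = x) ∧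
      (∀ j S, j ∉ S → ∀ x, f (insert j S) x = f {j} x * f S x) ∧
      (∀ j x, f {j} x ∈ D j) ∧ (∀ j, ∀ x ∈ D j, f {j} x = x) ∧
      (∀ j k, k ≠ j → ∀ x ∈ D k, f {j} x = 1) := by
  have hc : Pairwise fun i j : ι => ∀ x y : G, x ∈ D i → y ∈ D j → Commute x y := by
    intro i j hij
    exact Subgroup.commute_of_normal_of_disjoint _ _ (hD.nor i) (hD.nor j)
      (hD.ind.pairwiseDisjoint hij)
  have hbij : Function.Bijective (Subgroup.noncommPiCoprod hc) := by
    refine ⟨Subgroup.injective_noncommPiCoprod_of_iSupIndep hD.ind, ?_⟩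
    rw [← MonoidHom.range_eq_top, Subgroup.noncommPiCoprod_range, hD.sup]
  let E : (∀ i, D i) ≃* G := MulEquiv.ofBijective _ hbij
  have hE : ∀ i (y : D i), E (Pi.mulSingle i y) = y := fun i y =>
    Subgroup.noncommPiCoprod_mulSingle (hcomm := hc) i y
  let p : Finset ι → ((∀ i, D i) →* (∀ i, D i)) := fun S =>
    { toFun := fun u i => if i ∈ S then u i else 1
      map_one' := by funext i; simp
      map_mul' := by intro u v; funext i; by_cases h : i ∈ S <;> simp [h] }
  have hp : ∀ S u i, p S u i = if i ∈ S then u i else 1 := fun _ _ _ => rfl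
  have hps : ∀ j u, p {j} u = Pi.mulSingle j (u j) := by
    intro j u
    funext i
    rw [hp]
    by_cases h : i = j
    · subst h; simp
    · simp [h]
  let f : Finset ι → (G →* G) := fun S =>
    E.toMonoidHom.comp ((p S).comp E.symm.toMonoidHom)
  have hf : ∀ S x, f S x = E (p S (E.symm x)) := fun _ _ => rfl
  have hEs : ∀ i x (hx : x ∈ D i), E.symm x = Pi.mulSingle i ⟨x, hx⟩ := by
    intro i x hx
    rw [MulEquiv.symm_apply_eq, hE]
  refine ⟨f, ?_, ?_, ?_, ?_, ?_, ?_, ?_⟩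
  · intro S g x
    rw [hf, hf]
    apply E.symm.injective
    rw [map_mul, map_mul, map_inv]
    simp only [MulEquiv.symm_apply_apply]
    rw [map_mul, map_mul, map_inv]
    funext i
    by_cases h : i ∈ S <;> simp [hp, h]
  · intro x
    rw [hf]
    have : p ∅ (E.symm x) = 1 := by funext i; simp [hp]
    rw [this, map_one]
  · intro x
    rw [hf]
    have : p Finset.univ (E.symm x) = E.symm x := by funext i; simp [hp]
    rw [this, MulEquiv.apply_symm_apply]
  · intro j S hj x
    rw [hf, hf, hf, ← map_mul]
    congr 1
    funext i
    rw [Pi.mul_apply, hp, hp, hp]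
    by_cases h : i = j
    · subst h; simp [hj]
    · simp [h]
  · intro j x
    rw [hf, hps, hE]
    exact Subtype.property _
  · intro j x hx
    rw [hf, hps, hE, hEs j x hx]; simp
  · intro j k hk x hx
    rw [hf, hps, hE, hEs k x hx]; simp [hk.symm]

theorem kbisup {G : Type*} [Group G] {ι : Type*} (D : ι → Subgroup G) (hD : ∀ i, (D i).Normal)
    (P : ι → Prop) : (⨆ k, ⨆ (_ : P k), D k).Normal := by
  refine ⟨fun x hx g => ?_⟩
  have h : (⨆ k, ⨆ (_ : P k), D k) ≤
      (⨆ k, ⨆ (_ : P k), D k).comap (MulAut.conj g).toMonoidHom := by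
    refine iSup₂_le fun k hk y hy => ?_
    have h1 : g * y * g⁻¹ ∈ D k := (hD k).conj_mem y hy g
    exact (le_iSup₂_of_le k hk le_rfl : D k ≤ ⨆ k, ⨆ (_ : P k), D k) h1
  exact h hx

theorem kexch {G : Type*} [Group G] [Finite G] {ι κ : Type*} [Fintype ι] [DecidableEq ι]
    [Fintype κ] [DecidableEq κ] (D : ι → Subgroup G) (H : κ → Subgroup G) (hD : KDec D)
    (hH : KDec H) (i : ι) :
    ∃ j, Nonempty (D i ≃* H j) ∧ D i ⊔ Subgroup.center G = H j ⊔ Subgroup.center G ∧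
      Disjoint (H j) (⨆ k, ⨆ (_ : k ≠ i), D k) ∧ H j ⊔ (⨆ k, ⨆ (_ : k ≠ i), D k) = ⊤ := by
  obtain ⟨e', he1, -, -, -, he5, he6, he7⟩ := kproj D hD
  obtain ⟨f, hf1, hf2, hf3, hf4, hf5, hf6, hf7⟩ := kproj H hH
  set e := e' {i} with he
  set K := ⨆ k, ⨆ (_ : k ≠ i), D k with hKdef
  have hDn := hD.nor
  have hHn := hH.nor
  have hKn : K.Normal := by
    rw [hKdef]
    exact kbisup D hDn _
  have hAK : D i ⊔ K = ⊤ := by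
    rw [eq_top_iff, ← hD.sup]
    refine iSup_le fun k => ?_
    by_cases h : k = i
    · subst h; exact le_sup_left
    · exact le_sup_of_le_right (le_iSup₂_of_le k h le_rfl)
  have hdisj : Disjoint (D i) K := hD.ind i
  have hKe : K ≤ e.ker := iSup₂_le fun k hk x hx => he7 i k hk x hx
  have heK : e.ker ≤ K := by
    intro g hg
    have : g ∈ D i ⊔ K := hAK ▸ Subgroup.mem_top g
    obtain ⟨a, ha, k, hk, rfl⟩ := Subgroup.mem_sup_of_normal_right.1 this
    rw [MonoidHom.mem_ker, map_mul, he6 i a ha, MonoidHom.mem_ker.1 (hKe hk), mul_one] at hg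
    rw [hg, one_mul]; exact hk
  let eA : G →* D i := e.codRestrict (D i) (he5 i)
  have heA : ∀ x, (eA x : G) = e x := fun _ => rfl
  let Θ : Finset κ → (D i →* D i) := fun S => eA.comp ((f S).comp (D i).subtype)
  have hΘ : ∀ S x, (Θ S x : G) = e (f S x) := fun _ _ => rfl
  have hΘe : ∀ S, KEqv (Θ S) := by
    intro S g x
    apply Subtype.ext
    simp only [hΘ, Subgroup.coe_mul, Subgroup.coe_inv]
    rw [hf1 S, he1]
  have key : ∀ S : Finset κ, Function.Bijective (Θ S) → ∃ j, Function.Bijective (Θ {j}) := by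
    intro S
    induction S using Finset.induction_on with
    | empty =>
      intro hb
      exfalso
      have := (hD.ide i).1
      obtain ⟨x, hx⟩ := exists_ne (1 : D i)
      apply hx
      apply hb.1
      apply Subtype.ext
      rw [hΘ, hΘ, hf2, hf2]
    | insert j S hj ih =>
      intro hb
      have hadd : ∀ x, Θ (insert j S) x = Θ {j} x * Θ S x := by
        intro x
        apply Subtype.ext
        rw [Subgroup.coe_mul, hΘ, hΘ, hΘ, hf4 j S hj, map_mul]
      rcases kadd (hD.ide i) (Θ {j}) (Θ S) (Θ (insert j S)) (hΘe _) (hΘe _) hadd hb with h | h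
      · exact ⟨j, h⟩
      · exact ih h
  obtain ⟨j, hj⟩ := key Finset.univ (by
    have : (Θ Finset.univ : D i → D i) = id := by
      funext x
      apply Subtype.ext
      rw [hΘ, hf3, he6 i x x.2]; rfl
    rw [this]; exact Function.bijective_id)
  let fA : D i →* H j := ((f {j}).codRestrict (H j) (hf5 j)).comp (D i).subtype
  have hfA : ∀ x, (fA x : G) = f {j} x := fun _ => rfl
  let eH : H j →* D i := eA.comp (H j).subtype
  have heH : ∀ x, (eH x : G) = e x := fun _ => rfl
  have hef : ∀ x, eH (fA x) = Θ {j} x := fun _ => rfl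
  let Ψ : H j →* H j := fA.comp eH
  have hΨ : ∀ x, (Ψ x : G) = f {j} (e x) := fun _ => rfl
  have hΨe : KEqv Ψ := by
    intro g x
    apply Subtype.ext
    simp only [hΨ, Subgroup.coe_mul, Subgroup.coe_inv]
    rw [he1, hf1]
  have hfinj : Function.Injective fA := by
    intro x y hxy
    apply hj.1
    rw [← hef, ← hef, hxy]
  have hΨb : Function.Bijective Ψ := by
    rcases kfitting (hH.ide j) Ψ hΨe with h | ⟨n, hn⟩
    · exact h
    exfalso
    have := (hD.ide i).1
    obtain ⟨x, hx⟩ := exists_ne (1 : D i)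
    have hsc : Function.Semiconj fA (Θ {j}) Ψ := fun x => rfl
    have h1 := (hsc.iterate_right n) x
    rw [hn] at h1
    have h2 : (Θ {j})^[n] x = 1 := hfinj (h1.trans (map_one fA).symm)
    have h3 : (Θ {j})^[n] 1 = 1 := Function.iterate_fixed (map_one _) n
    exact hx (hj.1.iterate n (h2.trans h3.symm))
  have hfb : Function.Bijective fA := by
    refine ⟨hfinj, fun y => ?_⟩
    obtain ⟨x, hx⟩ := hΨb.2 y
    exact ⟨eH x, hx⟩
  have heinj : Function.Injective eH := by
    intro x y hxy
    apply hΨb.1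
    change fA (eH x) = fA (eH y)
    rw [hxy]
  have hesurj : Function.Surjective eH := by
    intro y
    obtain ⟨x, hx⟩ := hj.2 y
    exact ⟨fA x, hx⟩
  have hHK : Disjoint (H j) K := by
    rw [Subgroup.disjoint_def]
    intro x hx hxK
    have : (⟨x, hx⟩ : H j) = 1 := by
      apply heinj
      apply Subtype.ext
      rw [heH, map_one]
      exact hKe hxK
    exact congrArg Subtype.val this
  have hHKs : H j ⊔ K = ⊤ := by
    rw [eq_top_iff]
    intro g _
    obtain ⟨h, hh⟩ := hesurj (eA g)
    have h1 : e h = e g := congrArg Subtype.val hh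
    have : g = h * ((h : G)⁻¹ * g) := by group
    rw [this]
    refine Subgroup.mul_mem_sup h.2 (heK ?_)
    rw [MonoidHom.mem_ker, map_mul, map_inv, h1]; group
  have hz : ∀ x : D i, (x : G)⁻¹ * f {j} x ∈ Subgroup.center G := by
    intro x
    have hcen : H j ⊔ K ≤ Subgroup.centralizer {(x : G)⁻¹ * f {j} x} := by
      refine sup_le ?_ ?_
      · intro h hh
        obtain ⟨b, hb⟩ := hfb.2 ⟨h, hh⟩
        have hb' : f {j} b = h := congrArg Subtype.val hb
        rw [Subgroup.mem_centralizer_singleton_iff]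
        have h1 := hf1 {j} x b
        rw [map_mul, map_mul, map_inv, hb'] at h1
        have h2 : f {j} x * h = x * h * (x : G)⁻¹ * f {j} x := by rw [← h1]; group
        rw [mul_assoc ((x : G)⁻¹), h2]; group
      · intro k hk
        have hkx : Commute (x : G) k :=
          Subgroup.commute_of_normal_of_disjoint _ _ (hDn i) hKn hdisj x k x.2 hk
        have h1 := hf1 {j} k x
        have h2 : k * x * k⁻¹ = x := by rw [← hkx.eq]; group
        rw [h2] at h1
        have h3 : Commute (f {j} x) k := by
          change f {j} x * k = k * f {j} x
          nth_rw 1 [h1]; group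
        rw [Subgroup.mem_centralizer_singleton_iff]
        first
        | exact (hkx.inv_left.mul_left h3).eq
        | exact (hkx.inv_left.mul_left h3).eq.symm
    rw [Subgroup.mem_center_iff]
    intro g
    have hg : g ∈ H j ⊔ K := hHKs ▸ Subgroup.mem_top g
    have := Subgroup.mem_centralizer_singleton_iff.1 (hcen hg)
    first
    | exact this
    | exact this.symm
  refine ⟨j, ⟨MulEquiv.ofBijective fA hfb⟩, ?_, hHK, hHKs⟩
  apply le_antisymm
  · refine sup_le ?_ le_sup_right
    intro x hx
    have h1 : x = f {j} x * (x⁻¹ * f {j} x)⁻¹ := by group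
    rw [h1]
    exact Subgroup.mul_mem_sup (hf5 j x) (inv_mem (hz ⟨x, hx⟩))
  · refine sup_le ?_ le_sup_right
    intro y hy
    obtain ⟨x, hx⟩ := hfb.2 ⟨y, hy⟩
    have hx' : f {j} x = y := congrArg Subtype.val hx
    have h1 : y = x * ((x : G)⁻¹ * f {j} x) := by rw [hx']; group
    rw [h1]
    exact Subgroup.mul_mem_sup x.2 (hz x)

theorem kupdate {G : Type*} [Group G] {ι : Type*} [DecidableEq ι] (D : ι → Subgroup G)
    (hD : KDec D) (i : ι) (B : Subgroup G) (hBn : B.Normal) (hB : DirectlyIndecomposable B)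
    (hdis : Disjoint B (⨆ k, ⨆ (_ : k ≠ i), D k)) (hsup : B ⊔ (⨆ k, ⨆ (_ : k ≠ i), D k) = ⊤) :
    KDec (Function.update D i B) := by
  refine ⟨?_, ?_, ?_, ?_⟩
  · intro k
    by_cases h : k = i
    · subst h; simpa using hBn
    · simpa [h] using hD.nor k
  · intro k
    by_cases h : k = i
    · subst h
      rw [Function.update_self]
      refine hdis.mono_right ?_
      refine iSup₂_le fun l hl => ?_
      rw [Function.update_of_ne hl]
      exact le_iSup₂_of_le l hl le_rfl
    · rw [Function.update_of_ne h]
      set L := ⨆ l, ⨆ (_ : l ≠ k ∧ l ≠ i), D l with hL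
      have hLn : L.Normal := by
        rw [hL]
        exact kbisup D hD.nor _
      have hle : (⨆ l, ⨆ (_ : l ≠ k), Function.update D i B l) ≤ B ⊔ L := by
        refine iSup₂_le fun l hl => ?_
        by_cases h' : l = i
        · subst h'; rw [Function.update_self]; exact le_sup_left
        · rw [Function.update_of_ne h']
          exact le_sup_of_le_right (le_iSup₂_of_le l ⟨hl, h'⟩ le_rfl)
      refine Disjoint.mono_right hle ?_
      rw [Subgroup.disjoint_def]
      intro x hx hxB
      obtain ⟨b, hb, y, hy, rfl⟩ := Subgroup.mem_sup_of_normal_right.1 hxB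
      have hyK : y ∈ ⨆ k, ⨆ (_ : k ≠ i), D k :=
        (iSup₂_le fun l hl => le_iSup₂_of_le l hl.2 le_rfl : L ≤ _) hy
      have hxK : b * y ∈ ⨆ k, ⨆ (_ : k ≠ i), D k :=
        (le_iSup₂_of_le k h le_rfl : D k ≤ _) hx
      have hbK := (Subgroup.mul_mem_cancel_right _ hyK).1 hxK
      have hb1 := Subgroup.disjoint_def.1 hdis hb hbK
      subst hb1
      rw [one_mul] at hx ⊢
      have hyk : y ∈ ⨆ l, ⨆ (_ : l ≠ k), D l :=
        (iSup₂_le fun l hl => le_iSup₂_of_le l hl.1 le_rfl : L ≤ _) hy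
      exact Subgroup.disjoint_def.1 (hD.ind k) hx hyk
  · rw [eq_top_iff, ← hsup]
    refine sup_le ?_ (iSup₂_le fun l hl => ?_)
    · exact le_iSup_of_le i (by rw [Function.update_self])
    · exact le_iSup_of_le l (by rw [Function.update_of_ne hl])
  · intro k
    by_cases h : k = i
    · subst h; rw [Function.update_self]; exact hB
    · rw [Function.update_of_ne h]; exact hD.ide k

theorem kiter {G : Type*} [Group G] [Finite G] {ι κ : Type*} [Fintype ι] [DecidableEq ι]
    [Fintype κ] [DecidableEq κ] (D : ι → Subgroup G) (H : κ → Subgroup G) (hD : KDec D)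
    (hH : KDec H) (S : Finset ι) :
    ∃ D' : ι → Subgroup G, KDec D' ∧ (∀ i ∈ S, ∃ j, D' i = H j) ∧
      ∀ i, Nonempty (D i ≃* D' i) ∧ D i ⊔ Subgroup.center G = D' i ⊔ Subgroup.center G := by
  induction S using Finset.induction_on with
  | empty => exact ⟨D, hD, by simp, fun i => ⟨⟨MulEquiv.refl _⟩, rfl⟩⟩
  | insert i S hi ih =>
    obtain ⟨D', hD', h1, h2⟩ := ih
    obtain ⟨j, ⟨T⟩, hz, hd, hs⟩ := kexch D' H hD' hH i
    refine ⟨Function.update D' i (H j),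
      kupdate D' hD' i (H j) (hH.nor j) (hH.ide j) hd hs, ?_, ?_⟩
    · intro k hk
      by_cases h : k = i
      · subst h; exact ⟨j, by rw [Function.update_self]⟩
      · rw [Function.update_of_ne h]
        exact h1 k (Finset.mem_of_mem_insert_of_ne hk h)
    · intro k
      by_cases h : k = i
      · subst h
        rw [Function.update_self]
        obtain ⟨⟨T'⟩, hz'⟩ := h2 k
        exact ⟨⟨T'.trans T⟩, hz'.trans hz⟩
      · rw [Function.update_of_ne h]
        exact h2 k


/-- Krull–Remak–Schmidt with centers: if `G = G₁ × ⋯ × Gₘ = H₁ × ⋯ × Hₙ` are two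
internal direct decompositions of a finite group into directly indecomposable factors,
then there is a permutation `σ` (in particular `n = m`) with `Gᵢ ≅ H_{σ(i)}` and
`GᵢZ(G) = H_{σ(i)}Z(G)` for all `i`. -/
theorem krull_remak_schmidt_with_center {G : Type*} [Group G] [Finite G]
    {m n : ℕ} (Gf : Fin m → Subgroup G) (Hf : Fin n → Subgroup G)
    (hGnormal : ∀ i, (Gf i).Normal) (hHnormal : ∀ j, (Hf j).Normal)
    (hGindep : iSupIndep Gf) (hHindep : iSupIndep Hf)
    (hGsup : ⨆ i, Gf i = ⊤) (hHsup : ⨆ j, Hf j = ⊤)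
    (hGind : ∀ i, DirectlyIndecomposable (Gf i))
    (hHind : ∀ j, DirectlyIndecomposable (Hf j)) :
    ∃ σ : Fin m ≃ Fin n, ∀ i,
      Nonempty (Gf i ≃* Hf (σ i)) ∧
      Gf i ⊔ Subgroup.center G = Hf (σ i) ⊔ Subgroup.center G := by
  obtain ⟨D', hD', h1, h2⟩ := kiter Gf Hf ⟨hGnormal, hGindep, hGsup, hGind⟩
    ⟨hHnormal, hHindep, hHsup, hHind⟩ Finset.univ
  choose σ hσ using fun i => h1 i (Finset.mem_univ i)
  have hne : ∀ j, Hf j ≠ ⊥ := by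
    intro j hj
    have := (hHind j).1
    exact (Subgroup.nontrivial_iff_ne_bot _).1 this hj
  have hinj : Function.Injective σ := by
    intro a b hab
    by_contra hne'
    have := hD'.ind.pairwiseDisjoint hne'
    rw [Function.onFun, hσ, hσ, hab, disjoint_self] at this
    exact hne _ this
  have hsurj : Function.Surjective σ := by
    intro j
    by_contra hno
    push Not at hno
    have h3 : (⊤ : Subgroup G) ≤ ⨆ k, ⨆ (_ : k ≠ j), Hf k := by
      rw [← hD'.sup]
      refine iSup_le fun i => ?_
      rw [hσ]
      exact le_iSup₂_of_le (σ i) (hno i) le_rfl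
    have h4 := (hHindep j).mono_right h3
    exact hne j (disjoint_top.1 h4)
  refine ⟨Equiv.ofBijective σ ⟨hinj, hsurj⟩, fun i => ?_⟩
  have := h2 i
  rw [hσ i] at this
  exact this
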